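/- Let r ∈ ℓ²(ℤ) have nonnegative entries, with norm ‖r‖ and tail norms E_N(r). There is an absolute constant C such that for every N ≥ 1, Σ_{|n|>N} Σ_{j≠n} Σ_{p≠n} r(j+p)²/((n-j)²(n-p)²) ≤ C(‖r‖²/N + E_N(r)²). -/

import Mathlib

open scoped ENNReal

/-- Inverse squares of the integers of absolute value larger than `k`. -/
noncomputable def invSqTail (k : ℕ) (a : ℤ) : ℝ≥0∞ :=
  if k < a.natAbs then ENNReal.ofReal (((a : ℝ) ^ 2)⁻¹) else 0

theorem tsum_nat_inv_sq_tail_le (k : ℕ) :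
    ∑' n : ℕ, (if k < n then ENNReal.ofReal (((n : ℝ) ^ 2)⁻¹) else 0) ≤
      ENNReal.ofReal (2 / (k + 1)) := by
  rw [ENNReal.tsum_eq_iSup_nat]
  refine iSup_le fun m => ?_
  rw [← Finset.sum_filter, ← ENNReal.ofReal_sum_of_nonneg (fun i _ => by positivity)]
  refine ENNReal.ofReal_le_ofReal (le_trans (le_of_eq ?_) (sum_Ioo_inv_sq_le k m))
  refine Finset.sum_congr ?_ fun _ _ => rfl
  ext i
  simp [and_comm]

theorem tsum_invSqTail_le (k : ℕ) :
    ∑' a : ℤ, invSqTail k a ≤ ENNReal.ofReal (4 / (k + 1)) := by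
  set f : ℕ → ℝ≥0∞ := fun n => if k < n then ENNReal.ofReal (((n : ℝ) ^ 2)⁻¹) else 0 with hf
  have h1 : (fun n : ℕ => invSqTail k (n : ℤ)) = f := by
    funext n; simp [invSqTail, hf]
  have h2 : (fun n : ℕ => invSqTail k (-((n : ℤ) + 1))) = fun n => f (n + 1) := by
    funext n
    have : (-((n : ℤ) + 1)).natAbs = n + 1 := by omega
    simp only [invSqTail, hf, this]
    push_cast
    rw [neg_sq]
  have h3 : HasSum (fun n : ℕ => invSqTail k (n : ℤ)) (∑' n, f n) := by
    rw [h1]; exact ENNReal.summable.hasSum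
  have h4 : HasSum (fun n : ℕ => invSqTail k (-((n : ℤ) + 1))) (∑' n, f (n + 1)) := by
    rw [h2]; exact ENNReal.summable.hasSum
  rw [(HasSum.of_nat_of_neg_add_one h3 h4).tsum_eq]
  have h5 : ∑' n, f (n + 1) ≤ ∑' n, f n :=
    ENNReal.tsum_comp_le_tsum_of_injective (add_left_injective 1) f
  have h6 := tsum_nat_inv_sq_tail_le k
  calc _ ≤ ENNReal.ofReal (2 / (k + 1)) + ENNReal.ofReal (2 / (k + 1)) :=
        add_le_add h6 (h5.trans h6)
    _ = _ := by
        rw [← ENNReal.ofReal_add (by positivity) (by positivity)]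
        congr 1; ring

theorem ofReal_tsum_le {ι : Type*} (f : ι → ℝ) (hf : ∀ i, 0 ≤ f i) :
    ENNReal.ofReal (∑' i, f i) ≤ ∑' i, ENNReal.ofReal (f i) := by
  by_cases h : Summable f
  · exact (ENNReal.ofReal_tsum_of_nonneg hf h).le
  · simp [tsum_eq_zero_of_not_summable h]

theorem tsum_convolution_le (F u v : ℤ → ℝ≥0∞) :
    ∑' n : ℤ, ∑' a : ℤ, ∑' b : ℤ, F (2 * n - a - b) * (u a * v b) ≤
      (∑' k, F k) * ((∑' a, u a) * ∑' b, v b) := by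
  calc _ = ∑' a : ℤ, ∑' b : ℤ, (∑' n : ℤ, F (2 * n - a - b)) * (u a * v b) := by
        rw [ENNReal.tsum_comm]
        refine tsum_congr fun a => ?_
        rw [ENNReal.tsum_comm]
        exact tsum_congr fun b => ENNReal.tsum_mul_right
    _ ≤ ∑' a : ℤ, ∑' b : ℤ, (∑' k, F k) * (u a * v b) := by
        refine ENNReal.tsum_le_tsum fun a => ENNReal.tsum_le_tsum fun b => mul_le_mul_left ?_ _
        refine ENNReal.tsum_comp_le_tsum_of_injective (f := fun n : ℤ => 2 * n - a - b) ?_ F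
        intro x y h
        simp only at h
        omega
    _ = _ := by simp only [ENNReal.tsum_mul_left, ENNReal.tsum_mul_right]

theorem weighted_le_tail_add (R : ℤ → ℝ≥0∞) (N : ℕ) (n a b : ℤ) (hn : (N : ℤ) < |n|) :
    R (2 * n - a - b) * (invSqTail 0 a * invSqTail 0 b) ≤
      {m : ℤ | (N : ℤ) ≤ |m|}.indicator R (2 * n - a - b) * (invSqTail 0 a * invSqTail 0 b) +
      (R (2 * n - a - b) * (invSqTail (N / 2) a * invSqTail 0 b) +
        R (2 * n - a - b) * (invSqTail 0 a * invSqTail (N / 2) b)) := by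
  have tail : ∀ c : ℤ, N / 2 < c.natAbs → invSqTail (N / 2) c = invSqTail 0 c := by
    intro c hc
    simp only [invSqTail, if_pos hc, if_pos (Nat.zero_lt_of_lt hc)]
  by_cases hk : (N : ℤ) ≤ |2 * n - a - b|
  · rw [Set.indicator_of_mem (show _ ∈ {m : ℤ | (N : ℤ) ≤ |m|} from hk)]
    exact le_self_add
  · have h : N / 2 < a.natAbs ∨ N / 2 < b.natAbs := by
      by_contra hc
      rw [Int.abs_eq_natAbs] at hk hn
      omega
    refine le_trans ?_ le_add_self
    rcases h with h | h
    · rw [tail a h]; exact le_self_add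
    · rw [tail b h]; exact le_add_self

theorem tsum_weighted_le (R : ℤ → ℝ≥0∞) (N : ℕ) :
    ∑' n : {n : ℤ // (N : ℤ) < |n|}, ∑' a : ℤ, ∑' b : ℤ,
        R (2 * n - a - b) * (invSqTail 0 a * invSqTail 0 b) ≤
      ENNReal.ofReal 64 * ((∑' k, R k) * ENNReal.ofReal (1 / (N + 1)) +
        ∑' m : {m : ℤ // (N : ℤ) ≤ |m|}, R m) := by
  set T : ℤ → ℝ≥0∞ := {m : ℤ | (N : ℤ) ≤ |m|}.indicator R
  have hTsum : ∑' m : {m : ℤ // (N : ℤ) ≤ |m|}, R m = ∑' m, T m :=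
    tsum_subtype {m : ℤ | (N : ℤ) ≤ |m|} R
  have h0 : ∑' a, invSqTail 0 a ≤ ENNReal.ofReal 4 := by
    simpa using tsum_invSqTail_le 0
  have hN : ∑' a, invSqTail (N / 2) a ≤ ENNReal.ofReal (8 * (1 / (N + 1))) := by
    refine (tsum_invSqTail_le _).trans (ENNReal.ofReal_le_ofReal ?_)
    have : (N : ℝ) + 1 ≤ 2 * ((N / 2 : ℕ) + 1) := by
      have : N + 1 ≤ 2 * (N / 2 + 1) := by omega
      exact_mod_cast this
    rw [mul_one_div, div_le_div_iff₀ (by positivity) (by positivity)]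
    linarith
  calc _ ≤ ∑' n : {n : ℤ // (N : ℤ) < |n|}, ∑' a : ℤ, ∑' b : ℤ,
        (T (2 * n - a - b) * (invSqTail 0 a * invSqTail 0 b) +
      (R (2 * n - a - b) * (invSqTail (N / 2) a * invSqTail 0 b) +
        R (2 * n - a - b) * (invSqTail 0 a * invSqTail (N / 2) b))) := by
        gcongr with n a b
        exact weighted_le_tail_add R N n a b n.2
    _ ≤ ∑' n : ℤ, ∑' a : ℤ, ∑' b : ℤ,
        (T (2 * n - a - b) * (invSqTail 0 a * invSqTail 0 b) +
      (R (2 * n - a - b) * (invSqTail (N / 2) a * invSqTail 0 b) +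
        R (2 * n - a - b) * (invSqTail 0 a * invSqTail (N / 2) b))) :=
        ENNReal.tsum_comp_le_tsum_of_injective Subtype.val_injective
          (fun n : ℤ => ∑' a : ℤ, ∑' b : ℤ,
            (T (2 * n - a - b) * (invSqTail 0 a * invSqTail 0 b) +
            (R (2 * n - a - b) * (invSqTail (N / 2) a * invSqTail 0 b) +
            R (2 * n - a - b) * (invSqTail 0 a * invSqTail (N / 2) b))))
    _ ≤ (∑' k, T k) * (ENNReal.ofReal 4 * ENNReal.ofReal 4) +
        ((∑' k, R k) * (ENNReal.ofReal (8 * (1 / (N + 1))) * ENNReal.ofReal 4) +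
          (∑' k, R k) * (ENNReal.ofReal 4 * ENNReal.ofReal (8 * (1 / (N + 1))))) := by
        simp only [ENNReal.tsum_add]
        gcongr
        · exact (tsum_convolution_le _ _ _).trans (by gcongr)
        · exact (tsum_convolution_le _ _ _).trans (by gcongr)
        · exact (tsum_convolution_le _ _ _).trans (by gcongr)
    _ = ENNReal.ofReal 64 * ((∑' k, R k) * ENNReal.ofReal (1 / (N + 1))) +
          ENNReal.ofReal 16 * ∑' k, T k := by
        rw [← mul_add, ← ENNReal.ofReal_mul (by positivity), ← ENNReal.ofReal_mul (by positivity),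
          ← ENNReal.ofReal_mul (by positivity), ← ENNReal.ofReal_add (by positivity) (by positivity),
          mul_left_comm (ENNReal.ofReal 64), ← ENNReal.ofReal_mul (by norm_num), add_comm,
          mul_comm _ (∑' k, T k)]
        congr 3 <;> ring
    _ ≤ _ := by
        rw [hTsum, mul_add]
        gcongr
        norm_num

theorem ofReal_tsum_tsum_le (r : ℤ → ℝ) (n : ℤ) :
    ENNReal.ofReal (∑' j : {j : ℤ // j ≠ n}, ∑' p : {p : ℤ // p ≠ n},
        (r ((j : ℤ) + (p : ℤ))) ^ 2 /
          (((n - (j : ℤ) : ℤ) : ℝ) ^ 2 * ((n - (p : ℤ) : ℤ) : ℝ) ^ 2)) ≤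
      ∑' a : ℤ, ∑' b : ℤ,
        ENNReal.ofReal (r (2 * n - a - b) ^ 2) * (invSqTail 0 a * invSqTail 0 b) := by
  have inj : Function.Injective fun j : {j : ℤ // j ≠ n} => n - (j : ℤ) := fun x y h =>
    Subtype.ext (by simpa using h)
  refine (ofReal_tsum_le _ fun j => tsum_nonneg fun p => by positivity).trans ?_
  refine le_trans (ENNReal.tsum_le_tsum fun j => ?_) (ENNReal.tsum_comp_le_tsum_of_injective inj _)
  refine (ofReal_tsum_le _ fun p => by positivity).trans ?_
  refine le_trans (ENNReal.tsum_le_tsum fun p => ?_) (ENNReal.tsum_comp_le_tsum_of_injective inj _)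
  have hj : 0 < (n - (j : ℤ)).natAbs := by have := j.2; omega
  have hp : 0 < (n - (p : ℤ)).natAbs := by have := p.2; omega
  simp only [invSqTail, if_pos hj, if_pos hp]
  rw [← ENNReal.ofReal_mul (by positivity), ← ENNReal.ofReal_mul (by positivity),
    show 2 * n - (n - (j : ℤ)) - (n - (p : ℤ)) = j + p by ring, div_eq_mul_inv, mul_inv]

theorem stmt_8 :
    ∃ C : ℝ, 0 < C ∧ ∀ (r : ℤ → ℝ), (∀ k, 0 ≤ r k) →
      Summable (fun k => (r k) ^ 2) → ∀ N : ℕ, 1 ≤ N →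
      ∑' n : {n : ℤ // (N : ℤ) < |n|}, ∑' j : {j : ℤ // j ≠ (n : ℤ)},
        ∑' p : {p : ℤ // p ≠ (n : ℤ)},
          (r ((j : ℤ) + (p : ℤ))) ^ 2 /
            ((((n : ℤ) - (j : ℤ) : ℤ) : ℝ) ^ 2 * (((n : ℤ) - (p : ℤ) : ℤ) : ℝ) ^ 2) ≤
        C * ((∑' k : ℤ, (r k) ^ 2) / N +
          ∑' m : {m : ℤ // (N : ℤ) ≤ |m|}, (r (m : ℤ)) ^ 2) := by
  refine ⟨64, by norm_num, fun r _ hs N hN => ?_⟩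
  have hN' : (0 : ℝ) < N := by exact_mod_cast hN
  have hS : 0 ≤ ∑' k : ℤ, (r k) ^ 2 := tsum_nonneg fun k => sq_nonneg _
  have hE : 0 ≤ ∑' m : {m : ℤ // (N : ℤ) ≤ |m|}, (r (m : ℤ)) ^ 2 :=
    tsum_nonneg fun k => sq_nonneg _
  rw [← ENNReal.ofReal_le_ofReal_iff (by positivity)]
  refine (ofReal_tsum_le _ fun n => tsum_nonneg fun j => tsum_nonneg fun p => by positivity).trans ?_
  refine le_trans (ENNReal.tsum_le_tsum fun n => ofReal_tsum_tsum_le r (n : ℤ)) ?_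
  refine (tsum_weighted_le (fun k => ENNReal.ofReal (r k ^ 2)) N).trans ?_
  rw [← ENNReal.ofReal_tsum_of_nonneg (fun k => sq_nonneg _) hs,
    ← ENNReal.ofReal_tsum_of_nonneg (fun k => sq_nonneg _)
      (hs.comp_injective (Subtype.val_injective (p := fun m : ℤ => (N : ℤ) ≤ |m|))),
    ← ENNReal.ofReal_mul hS, ← ENNReal.ofReal_add (by positivity) hE,
    ← ENNReal.ofReal_mul (by positivity)]
  refine ENNReal.ofReal_le_ofReal ?_
  rw [div_eq_mul_one_div (∑' k : ℤ, (r k) ^ 2) (N : ℝ)]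
  gcongr
  linarith
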